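/- Let m, n : ℕ, t_i < t_f in ℝ, and let M : ℝ → Matrix (Fin m) (Fin n) ℝ be continuous on [t_i, t_f]. Then the observability Gramian W = ∫_{t_i}^{t_f} (M(t))ᵀ * M(t) dt is positive definite (i.e., yᵀ W y > 0 for every y ≠ 0) if and only if for every y ∈ ℝⁿ with y ≠ 0 there exists t ∈ [t_i, t_f] such that M(t) ⬝ᵥ y ≠ 0. -/

import Mathlib

open Matrix

/-- The quadratic form of an entrywise integral of matrices is the integral of the quadratic
forms. -/
lemma dotProduct_intervalIntegral_mulVec {n : Type*} [Fintype n] {a b : ℝ}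
    {A : ℝ → Matrix n n ℝ}
    (hA : ∀ i j, IntervalIntegrable (fun t => A t i j) MeasureTheory.volume a b) (y : n → ℝ) :
    y ⬝ᵥ ((Matrix.of fun i j => ∫ t in a..b, A t i j) *ᵥ y) =
      ∫ t in a..b, y ⬝ᵥ (A t *ᵥ y) := by
  have hrow (i : n) :
      IntervalIntegrable (fun t => ∑ j, A t i j * y j) MeasureTheory.volume a b := by
    simpa only [Finset.sum_fn] using
      IntervalIntegrable.sum Finset.univ fun j _ => (hA i j).mul_const (y j)
  simp only [dotProduct, mulVec, Matrix.of_apply]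
  rw [intervalIntegral.integral_finsetSum fun i _ => (hrow i).const_mul _]
  refine Finset.sum_congr rfl fun i _ => ?_
  rw [intervalIntegral.integral_const_mul,
    intervalIntegral.integral_finsetSum fun j _ => (hA i j).mul_const _]
  simp only [intervalIntegral.integral_mul_const]

/-- The quadratic form of `Aᵀ A` at `y` is the square of `A y`. -/
lemma dotProduct_transpose_mul_self_mulVec {m n R : Type*} [Fintype m] [Fintype n]
    [CommSemiring R] (A : Matrix m n R) (y : n → R) :
    y ⬝ᵥ ((Aᵀ * A) *ᵥ y) = (A *ᵥ y) ⬝ᵥ (A *ᵥ y) := by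
  rw [← mulVec_mulVec, dotProduct_mulVec, vecMul_transpose]

/-- The observability Gramian `W = ∫ M(t)ᵀ M(t) dt` (entrywise integral) is positive
definite iff for every nonzero `y` there is a time `t ∈ [ti, tf]` with `M(t) y ≠ 0`. -/
theorem gramian_posDef_iff
    (m n : ℕ) (ti tf : ℝ) (hlt : ti < tf)
    (M : ℝ → Matrix (Fin m) (Fin n) ℝ)
    (hM : ContinuousOn M (Set.Icc ti tf)) :
    (∀ y : Fin n → ℝ, y ≠ 0 →
        0 < y ⬝ᵥ ((Matrix.of fun i j => ∫ t in ti..tf, ((M t)ᵀ * M t) i j) *ᵥ y))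
      ↔ (∀ y : Fin n → ℝ, y ≠ 0 → ∃ t ∈ Set.Icc ti tf, M t *ᵥ y ≠ 0) := by
  have hG : ContinuousOn (fun t => (M t)ᵀ * M t) (Set.Icc ti tf) :=
    (continuous_id.matrix_transpose.matrix_mul continuous_id).comp_continuousOn hM
  have hint : ∀ i j, IntervalIntegrable (fun t => ((M t)ᵀ * M t) i j)
      MeasureTheory.volume ti tf := fun i j =>
    ((continuous_id.matrix_elem i j).comp_continuousOn hG).intervalIntegrable_of_Icc hlt.le
  refine forall₂_congr fun y _ => ?_
  rw [dotProduct_intervalIntegral_mulVec hint]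
  simp only [dotProduct_transpose_mul_self_mulVec]
  have hnonneg (t : ℝ) : 0 ≤ (M t *ᵥ y) ⬝ᵥ (M t *ᵥ y) :=
    Finset.sum_nonneg fun i _ => mul_self_nonneg _
  constructor
  · intro hpos
    by_contra! hzero
    refine hpos.ne' ((intervalIntegral.integral_congr fun t ht => ?_).trans
      intervalIntegral.integral_zero)
    rw [Set.uIcc_of_le hlt.le] at ht
    simp [hzero t ht]
  · rintro ⟨t, ht, hne⟩
    have hy : ContinuousOn (fun t => M t *ᵥ y) (Set.Icc ti tf) :=
      (continuous_id.matrix_mulVec continuous_const).comp_continuousOn hM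
    have hc : ContinuousOn (fun t => (M t *ᵥ y) ⬝ᵥ (M t *ᵥ y)) (Set.Icc ti tf) :=
      (continuous_id.dotProduct continuous_id).comp_continuousOn hy
    exact intervalIntegral.integral_pos hlt hc (fun s _ => hnonneg s)
      ⟨t, ht, (hnonneg t).lt_of_ne' (dotProduct_self_eq_zero.not.mpr hne)⟩
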